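/- arXiv:1412.7595 — 3 statements merged into one kernel-verified Lean document; each statement's English description precedes it below -/
import Mathlib

section
/- For every natural number m with 0 < m·h < D(s₀), if s_m ∈ (0, s₀) satisfies D(s₀) − D(s_m) = m·h, then the entry time of the (m+1)-th clip satisfies t_m = T(s₀) − T(s_m) = T(s₀) − 1000·((T(s₀)/1000)^{D_RATE} − m·h/A)^{1/D_RATE}. -/
/-- Flinging model: for a natural `m` with `0 < m·h < D(s₀)`, if `s_m ∈ (0, s₀)`
satisfies `D(s₀) − D(s_m) = m·h`, then the entry time of the `(m+1)`-th clip
satisfies `t_m = T(s₀) − T(s_m) = T(s₀) − 1000·((T(s₀)/1000)^D_RATE − m·h/A)^(1/D_RATE)`. -/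
theorem fling_entry_time_formula
    (Fric PCOEF A DRATE : ℝ) (hF : 0 < Fric) (hP : 0 < PCOEF)
    (hA : A = Fric * PCOEF) (hDR : DRATE = Real.log 0.78 / Real.log 0.9)
    (l T D : ℝ → ℝ)
    (hl : ∀ s, l s = Real.log (0.35 * s / A))
    (hT : ∀ s, T s = 1000 * Real.exp (l s / (DRATE - 1)))
    (hD : ∀ s, D s = A * Real.exp (DRATE / (DRATE - 1) * l s))
    (s₀ h : ℝ) (hs₀ : 0 < s₀) (hh : 0 < h)
    (m : ℕ) (hm0 : 0 < (m : ℝ) * h) (hmD : (m : ℝ) * h < D s₀)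
    (sm : ℝ) (hsm : sm ∈ Set.Ioo 0 s₀) (hsmD : D s₀ - D sm = m * h) :
    T s₀ - T sm =
      T s₀ - 1000 * ((T s₀ / 1000) ^ DRATE - m * h / A) ^ (1 / DRATE) := by
  have hA0 : A ≠ 0 := by rw [hA]; positivity
  have hDR0 : DRATE ≠ 0 := by
    rw [hDR]
    exact div_ne_zero (Real.log_neg (by norm_num) (by norm_num)).ne
      (Real.log_neg (by norm_num) (by norm_num)).ne
  have hpow : ∀ s, (T s / 1000) ^ DRATE = D s / A := by
    intro s
    rw [hT, hD, mul_div_cancel_left₀ _ (by norm_num), mul_div_cancel_left₀ _ hA0,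
      ← Real.exp_mul]
    congr 1
    ring
  have hdiff : (T s₀ / 1000) ^ DRATE - m * h / A = (T sm / 1000) ^ DRATE := by
    rw [hpow, hpow, ← hsmD]
    ring
  have hTm : 0 ≤ T sm / 1000 := by rw [hT]; positivity
  rw [hdiff, one_div, Real.rpow_rpow_inv hTm hDR0]
  ring
end

section
/- The watching durations of successive video clips during a fling are nondecreasing: for every natural number m ≥ 1 with (m+1)·h < D(s₀), setting t_k = T(s₀) − 1000·((T(s₀)/1000)^{D_RATE} − k·h/A)^{1/D_RATE}, one has t_{m+1} − t_m ≥ t_m − t_{m−1}. -/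
/-- Flinging model: the watching durations of successive clips are nondecreasing:
for every natural `m ≥ 1` with `(m+1)·h < D(s₀)`, with
`t_k = T(s₀) − 1000·((T(s₀)/1000)^D_RATE − k·h/A)^(1/D_RATE)` one has
`t_{m+1} − t_m ≥ t_m − t_{m−1}`. -/
theorem fling_watch_durations_nondecreasing
    (Fric PCOEF A DRATE : ℝ) (hF : 0 < Fric) (hP : 0 < PCOEF)
    (hA : A = Fric * PCOEF) (hDR : DRATE = Real.log 0.78 / Real.log 0.9)
    (l T D : ℝ → ℝ)
    (hl : ∀ s, l s = Real.log (0.35 * s / A))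
    (hT : ∀ s, T s = 1000 * Real.exp (l s / (DRATE - 1)))
    (hD : ∀ s, D s = A * Real.exp (DRATE / (DRATE - 1) * l s))
    (s₀ h : ℝ) (hs₀ : 0 < s₀) (hh : 0 < h)
    (t : ℕ → ℝ)
    (ht : ∀ k : ℕ,
      t k = T s₀ - 1000 * ((T s₀ / 1000) ^ DRATE - k * h / A) ^ (1 / DRATE))
    (m : ℕ) (hm1 : 1 ≤ m) (hm : ((m : ℝ) + 1) * h < D s₀) :
    t (m + 1) - t m ≥ t m - t (m - 1) := by
  have hA0 : 0 < A := hA ▸ mul_pos hF hP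
  have hD1 : 1 ≤ DRATE := by
    have h9 : Real.log 0.9 < 0 := Real.log_neg (by norm_num) (by norm_num)
    rw [hDR, one_le_div_of_neg h9]
    exact Real.log_le_log (by norm_num) (by norm_num)
  have hX : (T s₀ / 1000) ^ DRATE = D s₀ / A := by
    rw [hT, hD, mul_div_cancel_left₀ _ (by norm_num : (1000 : ℝ) ≠ 0),
      mul_div_cancel_left₀ _ hA0.ne', ← Real.exp_mul]
    congr 1
    ring
  obtain ⟨n, rfl⟩ := Nat.exists_eq_add_of_le' hm1
  have hp0 : 0 ≤ 1 / DRATE := by positivity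
  have hp1 : 1 / DRATE ≤ 1 := div_le_one_of_le₀ hD1 (by positivity)
  push_cast at hm
  have hsmall : 0 ≤ D s₀ / A - ((n : ℝ) + 1 + 1) * h / A := by
    rw [← sub_div]
    exact div_nonneg (by linarith) hA0.le
  have hstep : 0 ≤ h / A := by positivity
  have hlarge : 0 ≤ D s₀ / A - (n : ℝ) * h / A := by
    linear_combination hsmall + 2 * hstep
  have hconc := (Real.concaveOn_rpow hp0 hp1).2 (Set.mem_Ici.2 hsmall) (Set.mem_Ici.2 hlarge)
    (by norm_num : (0 : ℝ) ≤ 1 / 2) (by norm_num : (0 : ℝ) ≤ 1 / 2) (by norm_num)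
  have hmid : (1 / 2 : ℝ) • (D s₀ / A - ((n : ℝ) + 1 + 1) * h / A)
      + (1 / 2 : ℝ) • (D s₀ / A - (n : ℝ) * h / A) = D s₀ / A - ((n : ℝ) + 1) * h / A := by
    simp only [smul_eq_mul]
    ring
  rw [hmid] at hconc
  simp only [smul_eq_mul] at hconc
  simp only [Nat.add_sub_cancel, ht, hX]
  push_cast
  linarith
end

section
/- Exchange-argument optimality of greedy unit allocation: let ι be a finite index set, W a natural number, and for each i ∈ ι let f_i : ℕ → ℝ be nondecreasing with nonincreasing marginal gains (f_i(k+1) − f_i(k) ≤ f_i(k) − f_i(k−1) for all k ≥ 1). If an allocation x : ι → ℕ satisfies Σ_i x_i = W and for all i, j ∈ ι with x_j ≥ 1 one has f_i(x_i + 1) − f_i(x_i) ≤ f_j(x_j) − f_j(x_j − 1), then for every allocation y : ι → ℕ with Σ_i y_i ≤ W, Σ_i f_i(y_i) ≤ Σ_i f_i(x_i). -/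
/-- A sequence with nonincreasing increments lies below any line through one of its points whose
slope separates the increments after that point from those before it. -/
theorem le_add_mul_sub_of_antitone_increments {g : ℕ → ℝ} {c : ℝ} {m : ℕ}
    (hg : Antitone fun k => g (k + 1) - g k)
    (hright : g (m + 1) - g m ≤ c) (hleft : 1 ≤ m → c ≤ g m - g (m - 1)) (n : ℕ) :
    g n ≤ g m + c * ((n : ℝ) - m) := by
  rcases le_total m n with h | h
  · induction n, h using Nat.le_induction with
    | base => simp
    | succ k hk ih =>
      have hinc : g (k + 1) - g k ≤ g (m + 1) - g m := hg hk
      push_cast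
      linarith
  · induction h using Nat.decreasingInduction with
    | self => simp
    | of_succ k hk ih =>
      have hinc : g (m - 1 + 1) - g (m - 1) ≤ g (k + 1) - g k := hg (by omega : k ≤ m - 1)
      rw [Nat.sub_add_cancel (by omega)] at hinc
      have hc := hleft (by omega)
      push_cast at ih
      linarith

/-- Exchange-argument optimality of greedy unit allocation: with a finite index
set `ι`, a budget `W : ℕ`, and for each `i` a nondecreasing function
`f i : ℕ → ℝ` with nonincreasing marginal gains, if an allocation `x` uses the
whole budget and satisfies the greedy exchange condition, then it maximizes
`∑ i, f i (y i)` over all allocations `y` within the budget. -/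
theorem greedy_unit_allocation_optimal
    {ι : Type*} [Fintype ι] (W : ℕ) (f : ι → ℕ → ℝ)
    (hmono : ∀ i : ι, ∀ k : ℕ, f i k ≤ f i (k + 1))
    (hconc : ∀ i : ι, ∀ k : ℕ, 1 ≤ k →
      f i (k + 1) - f i k ≤ f i k - f i (k - 1))
    (x : ι → ℕ) (hx : ∑ i, x i = W)
    (hexch : ∀ i j : ι, 1 ≤ x j →
      f i (x i + 1) - f i (x i) ≤ f j (x j) - f j (x j - 1)) :
    ∀ y : ι → ℕ, ∑ i, y i ≤ W → ∑ i, f i (y i) ≤ ∑ i, f i (x i) := by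
  intro y hy
  cases isEmpty_or_nonempty ι
  · simp
  obtain ⟨i₀, hi₀⟩ := Finite.exists_max fun i => f i (x i + 1) - f i (x i)
  set c := f i₀ (x i₀ + 1) - f i₀ (x i₀)
  have hc : 0 ≤ c := sub_nonneg.2 (hmono i₀ (x i₀))
  have hbound : ∀ i, f i (y i) ≤ f i (x i) + c * ((y i : ℝ) - x i) := fun i =>
    le_add_mul_sub_of_antitone_increments
      (antitone_nat_of_succ_le fun k => by simpa using hconc i (k + 1) (by omega))
      (hi₀ i) (hexch i₀ i) (y i)
  have hbudget : ∑ i, (y i : ℝ) ≤ ∑ i, (x i : ℝ) := by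
    exact_mod_cast hy.trans hx.ge
  calc ∑ i, f i (y i) ≤ ∑ i, (f i (x i) + c * ((y i : ℝ) - x i)) :=
        Finset.sum_le_sum fun i _ => hbound i
    _ = ∑ i, f i (x i) + c * (∑ i, (y i : ℝ) - ∑ i, (x i : ℝ)) := by
        rw [Finset.sum_add_distrib, ← Finset.mul_sum, Finset.sum_sub_distrib]
    _ ≤ ∑ i, f i (x i) :=
        add_le_of_nonpos_right (mul_nonpos_of_nonneg_of_nonpos hc (sub_nonpos.2 hbudget))
end
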